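/- Let N ≥ 2 and let P be a real eigenfunction of −Δ_{S^{N−1}} with eigenvalue λ_ℓ = ℓ(N−2+ℓ). Then the constant ((N−2)/2)^2 + λ_ℓ in the Hardy inequality on C_0^∞(ℝ^N \ F_P) is optimal: the infimum of ∫ |∇u|^2 dx over all u ∈ C_0^∞(ℝ^N \ F_P) with ∫ |u|^2/|x|^2 dx = 1 equals ((N−2)/2)^2 + λ_ℓ. -/

import Mathlib

open MeasureTheory Real Metric

noncomputable section

/-- Euclidean Laplacian `Δ f = ∑ᵢ ∂²f/∂xᵢ²` on `ℝ^N`. -/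
def lap {N : ℕ} {F : Type} [NormedAddCommGroup F] [NormedSpace ℝ F]
    (f : EuclideanSpace ℝ (Fin N) → F) (x : EuclideanSpace ℝ (Fin N)) : F :=
  ∑ i : Fin N, fderiv ℝ (fun y => fderiv ℝ f y (EuclideanSpace.single i 1)) x
    (EuclideanSpace.single i 1)

/-- Squared norm of the gradient: `‖∇f(x)‖² = ∑ᵢ ‖∂f/∂xᵢ(x)‖²`. -/
def gradSq {N : ℕ} {F : Type} [NormedAddCommGroup F] [NormedSpace ℝ F]
    (f : EuclideanSpace ℝ (Fin N) → F) (x : EuclideanSpace ℝ (Fin N)) : ℝ :=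
  ∑ i : Fin N, ‖fderiv ℝ f x (EuclideanSpace.single i 1)‖ ^ 2

/-- `P : ℝ^N → ℝ`, viewed via its restriction to the unit sphere `S^{N-1}`, is an
eigenfunction of the negative Laplace-Beltrami operator `-Δ_{S^{N-1}}` with eigenvalue
`λ_ℓ = ℓ(N-2+ℓ)`.  This is characterized by the smoothness and harmonicity on `ℝ^N \ {0}`
of the degree-`ℓ` homogeneous extension `x ↦ ‖x‖^ℓ P(x/‖x‖)`. -/
def IsSphEigen (N ℓ : ℕ) (P : EuclideanSpace ℝ (Fin N) → ℝ) : Prop :=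
  ContDiffOn ℝ (⊤ : ℕ∞) (fun x : EuclideanSpace ℝ (Fin N) => ‖x‖ ^ ℓ * P (‖x‖⁻¹ • x)) {0}ᶜ ∧
  ∀ x : EuclideanSpace ℝ (Fin N), x ≠ 0 →
    lap (fun y : EuclideanSpace ℝ (Fin N) => ‖y‖ ^ ℓ * P (‖y‖⁻¹ • y)) x = 0

/-- `P` is not identically zero on the unit sphere. -/
def SphNonzero (N : ℕ) (P : EuclideanSpace ℝ (Fin N) → ℝ) : Prop :=
  ∃ ω : EuclideanSpace ℝ (Fin N), ‖ω‖ = 1 ∧ P ω ≠ 0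

/-- `F_P`: the cone over the zero set of `P` on the sphere, together with the origin. -/
def conicZeroSet (N : ℕ) (P : EuclideanSpace ℝ (Fin N) → ℝ) : Set (EuclideanSpace ℝ (Fin N)) :=
  {x : EuclideanSpace ℝ (Fin N) | x ≠ 0 ∧ P (‖x‖⁻¹ • x) = 0} ∪ {0}

/-- `P` has unit `L²` norm on the unit sphere (with its surface measure). -/
def SphNormalized (N : ℕ) (P : EuclideanSpace ℝ (Fin N) → ℝ) : Prop :=
  ∫ ω : sphere (0 : EuclideanSpace ℝ (Fin N)) 1, (P ω.1) ^ 2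
    ∂((volume : Measure (EuclideanSpace ℝ (Fin N))).toSphere) = 1

/-- The function `u_m(x) = m^{-1/2} φ(log‖x‖/m) ‖x‖^{-N/2+1} P(x/‖x‖)`. -/
def uFam (N : ℕ) (P : EuclideanSpace ℝ (Fin N) → ℝ) (φ : ℝ → ℝ) (m : ℕ)
    (x : EuclideanSpace ℝ (Fin N)) : ℝ :=
  (m : ℝ) ^ (-(1 : ℝ)/2) * φ (Real.log ‖x‖ / m) * ‖x‖ ^ (-(N : ℝ)/2 + 1) * P (‖x‖⁻¹ • x)


/-- The derivative of `log ‖·‖` away from the origin. -/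
theorem hasFDerivAt_log_norm {E : Type*} [NormedAddCommGroup E] [InnerProductSpace ℝ E]
    {x : E} (hx : x ≠ 0) :
    HasFDerivAt (fun y : E => Real.log ‖y‖) ((‖x‖ ^ 2)⁻¹ • innerSL ℝ x) x := by
  have h1 : HasFDerivAt (fun y : E => ‖y‖ ^ 2) (2 • innerSL ℝ x) x :=
    (hasStrictFDerivAt_norm_sq x).hasFDerivAt
  have h2 := (h1.log (by positivity)).const_mul (1 / 2 : ℝ)
  refine (h2.congr_fderiv ?_).congr_of_eventuallyEq (Filter.Eventually.of_forall fun y => ?_)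
  · ext v
    simp
    ring
  · simp [Real.log_pow]

theorem contDiffAt_log_norm {E : Type*} [NormedAddCommGroup E] [InnerProductSpace ℝ E]
    {x : E} (hx : x ≠ 0) {n : WithTop ℕ∞} :
    ContDiffAt ℝ n (fun y : E => Real.log ‖y‖) x :=
  (contDiffAt_norm ℝ hx).log (norm_ne_zero_iff.2 hx)

theorem continuous_hasCompactSupport_of_eq_zero_off {X : Type*} [TopologicalSpace X] [T2Space X]
    {F : Type*} [TopologicalSpace F] [Zero F] {f : X → F} {U K : Set X} (hU : IsOpen U)
    (hf : ContinuousOn f U) (hK : IsCompact K) (hKU : K ⊆ U) (h0 : ∀ x ∉ K, f x = 0) :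
    Continuous f ∧ HasCompactSupport f :=
  ⟨hf.continuous_of_tsupport_subset hU
    ((closure_minimal (Function.support_subset_iff'.2 h0) hK.isClosed).trans hKU),
    HasCompactSupport.intro hK h0⟩

theorem contDiff_of_eq_zero_off {E F : Type*} [NormedAddCommGroup E] [NormedSpace ℝ E]
    [NormedAddCommGroup F] [NormedSpace ℝ F] {n : WithTop ℕ∞} {f : E → F} {U K : Set E}
    (hU : IsOpen U) (hf : ContDiffOn ℝ n f U) (hK : IsClosed K) (hKU : K ⊆ U)
    (h0 : ∀ x ∉ K, f x = 0) : ContDiff ℝ n f := by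
  refine contDiff_iff_contDiffAt.2 fun x => ?_
  by_cases hx : x ∈ K
  · exact hf.contDiffAt (hU.mem_nhds (hKU hx))
  · refine (contDiffAt_const (c := (0 : F))).congr_of_eventuallyEq ?_
    filter_upwards [hK.isOpen_compl.mem_nhds hx] with y hy using h0 y hy

/-- The integral of a directional derivative of a compactly supported `C¹` function vanishes. -/
theorem integral_fderiv_apply_eq_zero {E : Type*} [NormedAddCommGroup E] [NormedSpace ℝ E]
    [FiniteDimensional ℝ E] [MeasurableSpace E] [BorelSpace E] (μ : Measure E)
    [μ.IsAddHaarMeasure] {f : E → ℝ} (hf : ContDiff ℝ 1 f) (hc : HasCompactSupport f) (v : E) :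
    ∫ x, fderiv ℝ f x v ∂μ = 0 := by
  have hi : Integrable (fun x => fderiv ℝ f x v) μ :=
    ((hf.continuous_fderiv one_ne_zero).clm_apply continuous_const).integrable_of_hasCompactSupport
      (hc.fderiv_apply ℝ v)
  have h := integral_mul_fderiv_eq_neg_fderiv_mul_of_integrable (μ := μ)
    (f := fun _ : E => (1 : ℝ)) (g := f) (v := v) (by simp) (by simpa using hi)
    (by simpa using hf.continuous.integrable_of_hasCompactSupport hc)
    (fun x _ => by fun_prop) (fun x _ => (hf.differentiable one_ne_zero) x)
  simpa using h

/-- Polar coordinates for the product of a function of `log ‖x‖`, a function that is homogeneous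
of degree zero, and the weight `‖x‖⁻ᵈ`, where `d` is the dimension. -/
theorem integral_log_norm_mul_homogeneous {E : Type*} [NormedAddCommGroup E] [NormedSpace ℝ E]
    [FiniteDimensional ℝ E] [Nontrivial E] [MeasurableSpace E] [BorelSpace E] (μ : Measure E)
    [μ.IsAddHaarMeasure] {g : E → ℝ} (hg : ∀ t : ℝ, 0 < t → ∀ x, g (t • x) = g x) (f : ℝ → ℝ) :
    ∫ x, g x * (f (Real.log ‖x‖) * (‖x‖ ^ Module.finrank ℝ E)⁻¹) ∂μ =
      (∫ ω : sphere (0 : E) 1, g ω ∂μ.toSphere) * ∫ t, f t := by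
  set d := Module.finrank ℝ E with hd
  have hdpos : 0 < d := Module.finrank_pos
  let φ : ℝ → ℝ := fun r => f (Real.log r) * (r ^ d)⁻¹
  have hradial : ∫ r : Set.Ioi (0 : ℝ), φ r ∂Measure.volumeIoiPow (d - 1) = ∫ t, f t := by
    simp only [Measure.volumeIoiPow, ENNReal.ofReal]
    rw [integral_withDensity_eq_integral_smul (by fun_prop),
      integral_subtype_comap measurableSet_Ioi fun a : ℝ => Real.toNNReal (a ^ (d - 1)) • φ a]
    have himage : Set.Ioi (0 : ℝ) = Real.exp '' Set.univ := by
      rw [Set.image_univ, Real.range_exp]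
    rw [himage, integral_image_eq_integral_abs_deriv_smul MeasurableSet.univ
      (fun x _ => (Real.hasDerivAt_exp x).hasDerivWithinAt) Real.exp_injective.injOn,
      setIntegral_univ]
    refine integral_congr_ae (Filter.Eventually.of_forall fun t => ?_)
    have he := Real.exp_pos t
    simp only [φ, NNReal.smul_def, smul_eq_mul, Real.log_exp, abs_of_pos he,
      Real.coe_toNNReal _ (pow_nonneg he.le (d - 1))]
    have : Real.exp t ^ d = Real.exp t * Real.exp t ^ (d - 1) := by
      rw [← pow_succ', Nat.sub_add_cancel hdpos]
    rw [this]
    field_simp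
  calc
    ∫ x, g x * φ ‖x‖ ∂μ = ∫ x : ({0}ᶜ : Set E), g x * φ ‖(x : E)‖ ∂(μ.comap (↑)) := by
      rw [integral_subtype_comap (measurableSet_singleton _).compl fun x => g x * φ ‖x‖,
        restrict_compl_singleton]
    _ = ∫ z : sphere (0 : E) 1 × Set.Ioi (0 : ℝ), g z.1 * φ z.2
          ∂μ.toSphere.prod (Measure.volumeIoiPow (d - 1)) := by
      rw [← μ.measurePreserving_homeomorphUnitSphereProd.integral_comp
        (Homeomorph.measurableEmbedding _)]
      refine integral_congr_ae (Filter.Eventually.of_forall fun x => ?_)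
      simp [hg _ (inv_pos.2 (norm_pos_iff.2 x.2))]
    _ = _ := by
      rw [← hradial]
      exact integral_prod_mul (fun ω : sphere (0 : E) 1 => g ω) (fun r : Set.Ioi (0 : ℝ) => φ r)

/-- The pointwise expansion behind the ground state identity, for one coordinate `T` of a real
vector field: `∂ᵥ (‖u‖² T) = ‖∂ᵥ u‖² - ‖∂ᵥ u - T u‖² + ‖u‖² (∂ᵥ T + T²)`. -/
theorem fderiv_normSq_mul_apply {E : Type*} [NormedAddCommGroup E] [NormedSpace ℝ E]
    {u : E → ℂ} {T : E → ℝ} {x : E} (hu : DifferentiableAt ℝ u x) (hT : DifferentiableAt ℝ T x)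
    (v : E) :
    fderiv ℝ (fun y => ‖u y‖ ^ 2 * T y) x v =
      ‖fderiv ℝ u x v‖ ^ 2 - ‖fderiv ℝ u x v - T x • u x‖ ^ 2
        + ‖u x‖ ^ 2 * (fderiv ℝ T x v + T x ^ 2) := by
  have h1 : HasFDerivAt (fun y => ‖u y‖ ^ 2) _ x := hu.hasFDerivAt.norm_sq
  rw [(h1.fun_mul hT.hasFDerivAt).fderiv]
  have h2 := norm_sub_sq_real (fderiv ℝ u x v) (T x • u x)
  rw [h2, real_inner_smul_right, norm_smul, mul_pow, Real.norm_eq_abs, sq_abs,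
    real_inner_comm]
  simp
  ring

/-- Ground state identity: if `div T + ‖T‖² = -V` on an open set containing the support of `u`,
then `∫ ‖∇u‖² = ∫ V ‖u‖² + ∫ ‖∇u - u T‖²`. -/
theorem integral_gradSq_eq_add {N : ℕ} {U : Set (EuclideanSpace ℝ (Fin N))} (hU : IsOpen U)
    {T : Fin N → EuclideanSpace ℝ (Fin N) → ℝ} (hT : ∀ i, ContDiffOn ℝ 1 (T i) U)
    {V : EuclideanSpace ℝ (Fin N) → ℝ} (hV : ContinuousOn V U)
    (hdiv : ∀ x ∈ U, ∑ i, (fderiv ℝ (T i) x (EuclideanSpace.single i 1) + T i x ^ 2) = - V x)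
    {u : EuclideanSpace ℝ (Fin N) → ℂ} (hu : ContDiff ℝ 1 u) (hc : HasCompactSupport u)
    (hs : tsupport u ⊆ U) :
    ∫ x, gradSq u x = (∫ x, V x * ‖u x‖ ^ 2) +
      ∫ x, ∑ i, ‖fderiv ℝ u x (EuclideanSpace.single i 1) - T i x • u x‖ ^ 2 := by
  have hu0 : ∀ x ∉ tsupport u, u x = 0 := fun x hx => image_eq_zero_of_notMem_tsupport hx
  have hdu0 : ∀ x ∉ tsupport u, fderiv ℝ u x = 0 := fun x hx =>
    image_eq_zero_of_notMem_tsupport fun h => hx (tsupport_fderiv_subset ℝ h)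
  have hdu : ∀ v, Continuous fun x => fderiv ℝ u x v := fun v =>
    (hu.continuous_fderiv one_ne_zero).clm_apply continuous_const
  have hf : ∀ i, ContDiff ℝ 1 fun x => ‖u x‖ ^ 2 * T i x := fun i => by
    refine contDiff_of_eq_zero_off hU (fun x hx => ?_) (isClosed_tsupport u) hs
      fun x hx => by simp [hu0 x hx]
    exact ((hu.contDiffAt.norm_sq ℝ).mul
      ((hT i).contDiffAt (hU.mem_nhds hx))).contDiffWithinAt
  have hfc : ∀ i, HasCompactSupport fun x => ‖u x‖ ^ 2 * T i x := fun i =>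
    HasCompactSupport.intro hc fun x hx => by simp [hu0 x hx]
  have hpt : ∀ x, gradSq u x = V x * ‖u x‖ ^ 2
      + (∑ i, ‖fderiv ℝ u x (EuclideanSpace.single i 1) - T i x • u x‖ ^ 2)
      + ∑ i, fderiv ℝ (fun y => ‖u y‖ ^ 2 * T i y) x (EuclideanSpace.single i 1) := fun x => by
    by_cases hx : x ∈ tsupport u
    · have h1 : ∀ i, fderiv ℝ (fun y => ‖u y‖ ^ 2 * T i y) x (EuclideanSpace.single i 1) = _ :=
        fun i => fderiv_normSq_mul_apply ((hu.differentiable one_ne_zero) x)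
          (((hT i).contDiffAt (hU.mem_nhds (hs hx))).differentiableAt one_ne_zero) _
      simp only [h1, Finset.sum_add_distrib, Finset.sum_sub_distrib, ← Finset.mul_sum]
      have h2 := hdiv x (hs hx)
      rw [Finset.sum_add_distrib] at h2
      rw [h2, gradSq]
      ring
    · have h1 : ∀ i, fderiv ℝ (fun y => ‖u y‖ ^ 2 * T i y) x = 0 := fun i =>
        image_eq_zero_of_notMem_tsupport fun h => hx <| (closure_mono fun y hy => by
          intro h; simp [h] at hy) (tsupport_fderiv_subset ℝ h)
      simp [gradSq, hu0 x hx, hdu0 x hx, h1]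
  have hi1 : Integrable fun x => V x * ‖u x‖ ^ 2 := by
    obtain ⟨h1, h2⟩ := continuous_hasCompactSupport_of_eq_zero_off hU
      (hV.mul (hu.continuous.norm.pow 2).continuousOn) hc hs fun x hx => by simp [hu0 x hx]
    exact h1.integrable_of_hasCompactSupport h2
  have hi2 : Integrable fun x =>
      ∑ i, ‖fderiv ℝ u x (EuclideanSpace.single i 1) - T i x • u x‖ ^ 2 := by
    obtain ⟨h1, h2⟩ := continuous_hasCompactSupport_of_eq_zero_off
      (f := fun x => ∑ i, ‖fderiv ℝ u x (EuclideanSpace.single i 1) - T i x • u x‖ ^ 2) hU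
      (continuousOn_finsetSum _ fun i _ => (((hdu _).continuousOn).sub
        ((hT i).continuousOn.smul hu.continuous.continuousOn)).norm.pow 2) hc hs
      fun x hx => by simp [hu0 x hx, hdu0 x hx]
    exact h1.integrable_of_hasCompactSupport h2
  have hi3 : ∀ i ∈ Finset.univ, Integrable fun x =>
      fderiv ℝ (fun y => ‖u y‖ ^ 2 * T i y) x (EuclideanSpace.single i 1) := fun i _ =>
    (((hf i).continuous_fderiv one_ne_zero).clm_apply
      continuous_const).integrable_of_hasCompactSupport ((hfc i).fderiv_apply ℝ _)
  simp_rw [hpt]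
  rw [integral_add (f := fun x => V x * ‖u x‖ ^ 2 + ∑ i, _) (hi1.add hi2)
    (integrable_finsetSum _ hi3), integral_add hi1 hi2,
    integral_finsetSum _ hi3, Finset.sum_eq_zero fun i _ =>
      integral_fderiv_apply_eq_zero volume (hf i) (hfc i) _, add_zero]

/-- The extension of `P` from the unit sphere that is homogeneous of degree `ℓ`. -/
def homExt (N ℓ : ℕ) (P : EuclideanSpace ℝ (Fin N) → ℝ) (x : EuclideanSpace ℝ (Fin N)) : ℝ :=
  ‖x‖ ^ ℓ * P (‖x‖⁻¹ • x)

/-- The logarithmic gradient of `x ↦ ‖x‖ ^ b * h x`. -/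
def logGrad {N : ℕ} (b : ℝ) (h : EuclideanSpace ℝ (Fin N) → ℝ) (i : Fin N)
    (x : EuclideanSpace ℝ (Fin N)) : ℝ :=
  b * (x i * (‖x‖ ^ 2)⁻¹) + fderiv ℝ h x (EuclideanSpace.single i 1) * (h x)⁻¹

theorem homExt_smul {N ℓ : ℕ} {P : EuclideanSpace ℝ (Fin N) → ℝ} {t : ℝ} (ht : 0 < t)
    (x : EuclideanSpace ℝ (Fin N)) : homExt N ℓ P (t • x) = t ^ ℓ * homExt N ℓ P x := by
  have : (t * ‖x‖)⁻¹ * t = ‖x‖⁻¹ := by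
    rw [mul_inv, mul_right_comm, inv_mul_cancel₀ ht.ne', one_mul]
  rw [homExt, homExt, norm_smul, Real.norm_of_nonneg ht.le, smul_smul, this, mul_pow, mul_assoc]

/-- Euler's identity for homogeneous functions. -/
theorem fderiv_homExt_self {N ℓ : ℕ} {P : EuclideanSpace ℝ (Fin N) → ℝ}
    {x : EuclideanSpace ℝ (Fin N)} (h : DifferentiableAt ℝ (homExt N ℓ P) x) :
    fderiv ℝ (homExt N ℓ P) x x = ℓ * homExt N ℓ P x := by
  have h1 : HasDerivAt (fun t : ℝ => t • x) x 1 := by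
    simpa using (hasDerivAt_id (1 : ℝ)).smul_const x
  have h2 : HasDerivAt (fun t : ℝ => homExt N ℓ P (t • x)) (fderiv ℝ (homExt N ℓ P) x x) 1 :=
    h.hasFDerivAt.comp_hasDerivAt_of_eq 1 h1 (one_smul _ x).symm
  have h3 : HasDerivAt (fun t : ℝ => t ^ ℓ * homExt N ℓ P x) (ℓ * homExt N ℓ P x) 1 := by
    simpa using (hasDerivAt_pow ℓ (1 : ℝ)).mul_const (homExt N ℓ P x)
  refine (h2.congr_of_eventuallyEq ?_).unique h3
  filter_upwards [lt_mem_nhds one_pos] with t ht using (homExt_smul ht x).symm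

theorem sum_coord_mul_apply_single {N : ℕ} (L : EuclideanSpace ℝ (Fin N) →L[ℝ] ℝ)
    (x : EuclideanSpace ℝ (Fin N)) :
    ∑ i, x i * L (EuclideanSpace.single i 1) = L x := by
  conv_rhs => rw [← (EuclideanSpace.basisFun (Fin N) ℝ).sum_repr x]
  simp

theorem hasFDerivAt_coord {N : ℕ} (i : Fin N) (x : EuclideanSpace ℝ (Fin N)) :
    HasFDerivAt (fun y : EuclideanSpace ℝ (Fin N) => y i)
      (EuclideanSpace.proj i : EuclideanSpace ℝ (Fin N) →L[ℝ] ℝ) x :=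
  (EuclideanSpace.proj i : EuclideanSpace ℝ (Fin N) →L[ℝ] ℝ).hasFDerivAt

theorem contDiffAt_logGrad {N : ℕ} (b : ℝ) {h : EuclideanSpace ℝ (Fin N) → ℝ} (i : Fin N)
    {x : EuclideanSpace ℝ (Fin N)} (hx : x ≠ 0) (hh : ContDiffAt ℝ 2 h x) (h0 : h x ≠ 0) :
    ContDiffAt ℝ 1 (logGrad b h i) x := by
  have h1 : ContDiffAt ℝ 1 (fun y => fderiv ℝ h y (EuclideanSpace.single i 1)) x :=
    (hh.fderiv_right (by norm_num)).clm_apply contDiffAt_const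
  have h2 : ContDiffAt ℝ 1 (fun y : EuclideanSpace ℝ (Fin N) => y i) x :=
    (EuclideanSpace.proj i : EuclideanSpace ℝ (Fin N) →L[ℝ] ℝ).contDiff.contDiffAt
  have h3 : ContDiffAt ℝ 1 (fun y : EuclideanSpace ℝ (Fin N) => (‖y‖ ^ 2)⁻¹) x :=
    (contDiff_norm_sq ℝ).contDiffAt.inv (by positivity)
  exact (contDiffAt_const.mul (h2.mul h3)).add (h1.mul ((hh.of_le (by norm_num)).inv h0))

theorem fderiv_logGrad_add_sq {N : ℕ} (b : ℝ) {h : EuclideanSpace ℝ (Fin N) → ℝ} (i : Fin N)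
    {x : EuclideanSpace ℝ (Fin N)} (hx : x ≠ 0) (hh : ContDiffAt ℝ 2 h x) (h0 : h x ≠ 0) :
    fderiv ℝ (logGrad b h i) x (EuclideanSpace.single i 1) + logGrad b h i x ^ 2 =
      b * (‖x‖ ^ 2)⁻¹ + (b ^ 2 - 2 * b) * ((‖x‖ ^ 2)⁻¹) ^ 2 * x i ^ 2
        + (h x)⁻¹ * fderiv ℝ (fun y => fderiv ℝ h y (EuclideanSpace.single i 1)) x
            (EuclideanSpace.single i 1)
        + 2 * b * (‖x‖ ^ 2)⁻¹ * (h x)⁻¹ *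
            (x i * fderiv ℝ h x (EuclideanSpace.single i 1)) := by
  have hd : DifferentiableAt ℝ (fun y => fderiv ℝ h y (EuclideanSpace.single i 1)) x :=
    ((hh.fderiv_right (m := 1) (by norm_num)).clm_apply contDiffAt_const).differentiableAt
      one_ne_zero
  have hn : HasFDerivAt (fun y : EuclideanSpace ℝ (Fin N) => ‖y‖ ^ 2) (2 • innerSL ℝ x) x :=
    (hasStrictFDerivAt_norm_sq x).hasFDerivAt
  have hne : ‖x‖ ^ 2 ≠ 0 := by positivity
  have h1 : HasFDerivAt (fun y : EuclideanSpace ℝ (Fin N) => (‖y‖ ^ 2)⁻¹) _ x :=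
    (hasDerivAt_inv hne).comp_hasFDerivAt x hn
  have h2 : HasFDerivAt (fun y => (h y)⁻¹) _ x :=
    (hasDerivAt_inv h0).comp_hasFDerivAt x (hh.differentiableAt two_ne_zero).hasFDerivAt
  have h3 : HasFDerivAt (logGrad b h i) _ x :=
    (((hasFDerivAt_coord i x).fun_mul h1).const_mul b).fun_add (hd.hasFDerivAt.fun_mul h2)
  rw [h3.fderiv, logGrad]
  simp [EuclideanSpace.inner_single_right]
  field_simp
  ring

/-- `div T + ‖T‖² = - c / ‖x‖²` for the logarithmic gradient `T` of
`‖x‖ ^ (-(N - 2) / 2 - ℓ) * h`, where `h` is harmonic and homogeneous of degree `ℓ`. -/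
theorem sum_fderiv_logGrad_add_sq {N ℓ : ℕ} {h : EuclideanSpace ℝ (Fin N) → ℝ}
    {x : EuclideanSpace ℝ (Fin N)} (hx : x ≠ 0) (hh : ContDiffAt ℝ 2 h x) (h0 : h x ≠ 0)
    (hlap : lap h x = 0) (heuler : fderiv ℝ h x x = ℓ * h x) :
    ∑ i, (fderiv ℝ (logGrad (-((N : ℝ) - 2) / 2 - ℓ) h i) x (EuclideanSpace.single i 1)
      + logGrad (-((N : ℝ) - 2) / 2 - ℓ) h i x ^ 2) =
      -(((((N : ℝ) - 2) / 2) ^ 2 + (ℓ : ℝ) * ((N : ℝ) - 2 + ℓ)) * (‖x‖ ^ 2)⁻¹) := by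
  have hne : ‖x‖ ^ 2 ≠ 0 := by positivity
  have hl : ∑ i, fderiv ℝ (fun y => fderiv ℝ h y (EuclideanSpace.single i 1)) x
      (EuclideanSpace.single i 1) = 0 := hlap
  simp_rw [fun i => fderiv_logGrad_add_sq (-((N : ℝ) - 2) / 2 - ℓ) i hx hh h0,
    Finset.sum_add_distrib, ← Finset.mul_sum, sum_coord_mul_apply_single, hl, heuler,
    ← EuclideanSpace.real_norm_sq_eq]
  simp only [Finset.sum_const, Finset.card_univ, Fintype.card_fin, nsmul_eq_mul]
  field_simp
  ring

theorem IsSphEigen.contDiffAt {N ℓ : ℕ} {P : EuclideanSpace ℝ (Fin N) → ℝ}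
    (hP : IsSphEigen N ℓ P) {x : EuclideanSpace ℝ (Fin N)} (hx : x ≠ 0) :
    ContDiffAt ℝ (⊤ : ℕ∞) (homExt N ℓ P) x :=
  hP.1.contDiffAt (isOpen_compl_singleton.mem_nhds hx)

theorem mem_compl_conicZeroSet {N ℓ : ℕ} {P : EuclideanSpace ℝ (Fin N) → ℝ}
    {x : EuclideanSpace ℝ (Fin N)} :
    x ∈ (conicZeroSet N P)ᶜ ↔ x ≠ 0 ∧ homExt N ℓ P x ≠ 0 := by
  by_cases hx : x = 0
  · simp [conicZeroSet, hx]
  · simp [conicZeroSet, homExt, hx]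

theorem IsSphEigen.isOpen_compl_conicZeroSet {N ℓ : ℕ} {P : EuclideanSpace ℝ (Fin N) → ℝ}
    (hP : IsSphEigen N ℓ P) : IsOpen (conicZeroSet N P)ᶜ := by
  have h : ContinuousOn (homExt N ℓ P) {0}ᶜ := hP.1.continuousOn
  have := h.isOpen_inter_preimage isOpen_compl_singleton
    (isOpen_compl_singleton (x := (0 : ℝ)))
  convert this using 1
  ext x
  simpa using mem_compl_conicZeroSet (ℓ := ℓ)

/-- Ground state representation of the Hardy functional. -/
theorem IsSphEigen.integral_gradSq_eq {N ℓ : ℕ} {P : EuclideanSpace ℝ (Fin N) → ℝ}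
    (hP : IsSphEigen N ℓ P) {u : EuclideanSpace ℝ (Fin N) → ℂ} (hu : ContDiff ℝ 1 u)
    (hc : HasCompactSupport u) (hs : tsupport u ⊆ (conicZeroSet N P)ᶜ) :
    ∫ x, gradSq u x =
      ((((N : ℝ) - 2) / 2) ^ 2 + (ℓ : ℝ) * ((N : ℝ) - 2 + ℓ)) * (∫ x, ‖u x‖ ^ 2 / ‖x‖ ^ 2) +
      ∫ x, ∑ i, ‖fderiv ℝ u x (EuclideanSpace.single i 1)
        - logGrad (-((N : ℝ) - 2) / 2 - ℓ) (homExt N ℓ P) i x • u x‖ ^ 2 := by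
  have hreg : ∀ x ∈ (conicZeroSet N P)ᶜ,
      x ≠ 0 ∧ ContDiffAt ℝ 2 (homExt N ℓ P) x ∧ homExt N ℓ P x ≠ 0 := fun x hx => by
    obtain ⟨h1, h2⟩ := (mem_compl_conicZeroSet (ℓ := ℓ)).1 hx
    exact ⟨h1, (hP.contDiffAt h1).of_le (WithTop.coe_le_coe.2 (le_top (a := (2 : ℕ∞)))), h2⟩
  rw [integral_gradSq_eq_add (T := logGrad (-((N : ℝ) - 2) / 2 - ℓ) (homExt N ℓ P)) (V := fun x =>
    ((((N : ℝ) - 2) / 2) ^ 2 + (ℓ : ℝ) * ((N : ℝ) - 2 + ℓ)) * (‖x‖ ^ 2)⁻¹)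
    hP.isOpen_compl_conicZeroSet ?_ ?_ ?_ hu hc hs]
  · rw [← integral_const_mul]
    simp only [mul_assoc, div_eq_mul_inv, mul_comm (_ ^ 2 : ℝ) (_ ^ 2 : ℝ)⁻¹]
  · intro i x hx
    obtain ⟨h1, h2, h3⟩ := hreg x hx
    exact (contDiffAt_logGrad _ i h1 h2 h3).contDiffWithinAt
  · refine continuousOn_const.mul ((continuous_norm.pow 2).continuousOn.inv₀ fun x hx => ?_)
    exact pow_ne_zero 2 (norm_ne_zero_iff.2 (hreg x hx).1)
  · intro x hx
    obtain ⟨h1, h2, h3⟩ := hreg x hx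
    exact sum_fderiv_logGrad_add_sq h1 h2 h3 (hP.2 x h1)
      (fderiv_homExt_self (h2.differentiableAt two_ne_zero))

/-- The extension of `P` from the unit sphere that is homogeneous of degree zero. -/
def radExt {N : ℕ} (P : EuclideanSpace ℝ (Fin N) → ℝ) (x : EuclideanSpace ℝ (Fin N)) : ℝ :=
  P (‖x‖⁻¹ • x)

theorem homExt_eq {N : ℕ} (ℓ : ℕ) (P : EuclideanSpace ℝ (Fin N) → ℝ)
    (x : EuclideanSpace ℝ (Fin N)) : homExt N ℓ P x = ‖x‖ ^ ℓ * radExt P x := rfl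

theorem radExt_smul {N : ℕ} (P : EuclideanSpace ℝ (Fin N) → ℝ) {t : ℝ} (ht : 0 < t)
    (x : EuclideanSpace ℝ (Fin N)) : radExt P (t • x) = radExt P x := by
  have : (t * ‖x‖)⁻¹ * t = ‖x‖⁻¹ := by
    rw [mul_inv, mul_right_comm, inv_mul_cancel₀ ht.ne', one_mul]
  rw [radExt, radExt, norm_smul, Real.norm_of_nonneg ht.le, smul_smul, this]

theorem IsSphEigen.contDiffOn_radExt {N ℓ : ℕ} {P : EuclideanSpace ℝ (Fin N) → ℝ}
    (hP : IsSphEigen N ℓ P) : ContDiffOn ℝ (⊤ : ℕ∞) (radExt P) {0}ᶜ := by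
  intro x hx
  have h1 : ContDiffAt ℝ (⊤ : ℕ∞) (fun y => (‖y‖ ^ ℓ)⁻¹ * homExt N ℓ P y) x :=
    (((contDiffAt_norm ℝ hx).pow ℓ).inv (pow_ne_zero ℓ (norm_ne_zero_iff.2 hx))).mul
      (hP.contDiffAt hx)
  refine (h1.congr_of_eventuallyEq ?_).contDiffWithinAt
  filter_upwards [isOpen_compl_singleton.mem_nhds hx] with y hy
  have : ‖y‖ ^ ℓ ≠ 0 := pow_ne_zero ℓ (norm_ne_zero_iff.2 hy)
  rw [homExt, radExt, inv_mul_cancel_left₀ this]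

/-- The ground state `‖x‖ ^ (-(N - 2) / 2) * P (x / ‖x‖)`. -/
def groundState (N ℓ : ℕ) (P : EuclideanSpace ℝ (Fin N) → ℝ) (x : EuclideanSpace ℝ (Fin N)) : ℝ :=
  Real.exp ((-((N : ℝ) - 2) / 2 - ℓ) * Real.log ‖x‖) * homExt N ℓ P x

theorem groundState_sq {N ℓ : ℕ} {P : EuclideanSpace ℝ (Fin N) → ℝ}
    {x : EuclideanSpace ℝ (Fin N)} (hx : x ≠ 0) :
    groundState N ℓ P x ^ 2 = radExt P x ^ 2 * (‖x‖ ^ 2 * (‖x‖ ^ N)⁻¹) := by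
  have hp : ∀ k : ℕ, ‖x‖ ^ k = Real.exp (k * Real.log ‖x‖) := fun k => by
    rw [Real.exp_nat_mul, Real.exp_log (norm_pos_iff.2 hx)]
  rw [groundState, homExt_eq, hp, hp, hp, ← Real.exp_neg, ← Real.exp_add, ← mul_assoc,
    ← Real.exp_add, mul_pow, ← Real.exp_nat_mul, mul_comm]
  congr 2
  push_cast
  ring

theorem IsSphEigen.contDiffAt_groundState {N ℓ : ℕ} {P : EuclideanSpace ℝ (Fin N) → ℝ}
    (hP : IsSphEigen N ℓ P) {x : EuclideanSpace ℝ (Fin N)} (hx : x ≠ 0) :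
    ContDiffAt ℝ (⊤ : ℕ∞) (groundState N ℓ P) x :=
  (contDiffAt_const.mul (contDiffAt_log_norm hx)).exp.mul (hP.contDiffAt hx)

theorem IsSphEigen.fderiv_groundState_mul_sub {N ℓ : ℕ} {P : EuclideanSpace ℝ (Fin N) → ℝ}
    (hP : IsSphEigen N ℓ P) {x : EuclideanSpace ℝ (Fin N)} (hx : x ∈ (conicZeroSet N P)ᶜ)
    {v : EuclideanSpace ℝ (Fin N) → ℝ} (hv : DifferentiableAt ℝ v x) (i : Fin N) :
    fderiv ℝ (fun y => ((groundState N ℓ P y * v y : ℝ) : ℂ)) x (EuclideanSpace.single i 1)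
      - logGrad (-((N : ℝ) - 2) / 2 - ℓ) (homExt N ℓ P) i x •
        ((groundState N ℓ P x * v x : ℝ) : ℂ) =
      ((groundState N ℓ P x * fderiv ℝ v x (EuclideanSpace.single i 1) : ℝ) : ℂ) := by
  obtain ⟨hx0, hh0⟩ := (mem_compl_conicZeroSet (ℓ := ℓ)).1 hx
  have h1 : HasFDerivAt (groundState N ℓ P) _ x :=
    ((hasFDerivAt_log_norm hx0).const_mul _).exp.fun_mul
      ((hP.contDiffAt hx0).differentiableAt (by simp)).hasFDerivAt
  have h2 := Complex.ofRealCLM.hasFDerivAt.comp x (h1.fun_mul hv.hasFDerivAt)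
  have h3 : fderiv ℝ (fun y => ((groundState N ℓ P y * v y : ℝ) : ℂ)) x = _ := h2.fderiv
  rw [h3, Complex.real_smul, ← Complex.ofReal_mul]
  simp only [ContinuousLinearMap.comp_apply, Complex.ofRealCLM_apply]
  rw [← Complex.ofReal_sub]
  congr 1
  simp [EuclideanSpace.inner_single_right, logGrad, groundState]
  field_simp
  ring

theorem isCompact_setOf_log_norm_mem_Icc {E : Type*} [NormedAddCommGroup E] [ProperSpace E]
    {κ : ℝ} (hκ : 0 < κ) {a b : ℝ} (ha : 0 < a) :
    IsCompact {x : E | κ * Real.log ‖x‖ ∈ Set.Icc a b} := by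
  have : {x : E | κ * Real.log ‖x‖ ∈ Set.Icc a b} =
      closedBall 0 (Real.exp (b / κ)) ∩ {x | Real.exp (a / κ) ≤ ‖x‖} := by
    ext x
    by_cases hx : x = 0
    · simp [hx, ha.not_ge, (Real.exp_pos _).not_ge]
    · have hx' := norm_pos_iff.2 hx
      simp [← Real.le_log_iff_exp_le hx', ← Real.log_le_iff_le_exp hx', div_le_iff₀' hκ,
        le_div_iff₀' hκ, and_comm]
  rw [this]
  exact (isCompact_closedBall _ _).inter_right (isClosed_le continuous_const continuous_norm)

theorem integrable_of_eq_zero_off_log_annulus {E : Type*} [NormedAddCommGroup E]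
    [NormedSpace ℝ E] [FiniteDimensional ℝ E] [MeasurableSpace E] [BorelSpace E] {μ : Measure E}
    [IsFiniteMeasureOnCompacts μ] {f : E → ℝ}
    {κ : ℝ} (hκ : 0 < κ) {a b : ℝ} (ha : 0 < a) (hf : ContinuousOn f {0}ᶜ)
    (h0 : ∀ x, κ * Real.log ‖x‖ ∉ Set.Icc a b → f x = 0) : Integrable f μ := by
  have : ProperSpace E := FiniteDimensional.proper_real E
  obtain ⟨h1, h2⟩ := continuous_hasCompactSupport_of_eq_zero_off isOpen_compl_singleton hf
    (isCompact_setOf_log_norm_mem_Icc hκ (b := b) ha)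
    (fun x hx h => by simp only [Set.mem_singleton_iff] at h; simp [h] at hx; linarith) h0
  exact h1.integrable_of_hasCompactSupport h2

theorem continuousOn_mul_log_norm {E : Type*} [NormedAddCommGroup E] (κ : ℝ) :
    ContinuousOn (fun x : E => κ * Real.log ‖x‖) {0}ᶜ :=
  continuousOn_const.mul (continuous_norm.continuousOn.log fun _ hx => norm_ne_zero_iff.2 hx)

theorem deriv_eq_zero_off {α : ℝ → ℝ} {s : Set ℝ} (hs : IsClosed s) (h : ∀ t ∉ s, α t = 0) :
    ∀ t ∉ s, deriv α t = 0 := fun t ht => by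
  have : α =ᶠ[nhds t] fun _ => 0 := by
    filter_upwards [hs.isOpen_compl.mem_nhds ht] with y hy using h y hy
  simpa using this.deriv_eq

/-- The cutoff in the radial and the angular variables. -/
def coneCutoff {N : ℕ} (P : EuclideanSpace ℝ (Fin N) → ℝ) (α β : ℝ → ℝ) (κ s : ℝ)
    (x : EuclideanSpace ℝ (Fin N)) : ℝ :=
  α (κ * Real.log ‖x‖) * β (s * radExt P x ^ 2)

/-- The angular energy density of `coneCutoff`, up to the factor `(t * deriv β t) ^ 2` with
`t = s * radExt P x ^ 2`. -/
def angularDensity {N : ℕ} (P : EuclideanSpace ℝ (Fin N) → ℝ) (α : ℝ → ℝ) (κ : ℝ)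
    (x : EuclideanSpace ℝ (Fin N)) : ℝ :=
  4 * (‖x‖ ^ 2 * (‖x‖ ^ N)⁻¹) * α (κ * Real.log ‖x‖) ^ 2 *
    ∑ i, fderiv ℝ (radExt P) x (EuclideanSpace.single i 1) ^ 2

theorem IsSphEigen.contDiffOn_coneCutoff {N ℓ : ℕ} {P : EuclideanSpace ℝ (Fin N) → ℝ}
    (hP : IsSphEigen N ℓ P) {α β : ℝ → ℝ} (hα : ContDiff ℝ (⊤ : ℕ∞) α)
    (hβ : ContDiff ℝ (⊤ : ℕ∞) β) (κ s : ℝ) :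
    ContDiffOn ℝ (⊤ : ℕ∞) (coneCutoff P α β κ s) {0}ᶜ := fun x hx =>
  (hα.contDiffAt.comp_contDiffWithinAt x
    (contDiffAt_const.mul (contDiffAt_log_norm hx)).contDiffWithinAt).mul
  (hβ.contDiffAt.comp_contDiffWithinAt x
    (contDiffWithinAt_const.mul ((hP.contDiffOn_radExt x hx).pow 2)))

theorem IsSphEigen.fderiv_coneCutoff {N ℓ : ℕ} {P : EuclideanSpace ℝ (Fin N) → ℝ}
    (hP : IsSphEigen N ℓ P) {α β : ℝ → ℝ} (hα : ContDiff ℝ (⊤ : ℕ∞) α)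
    (hβ : ContDiff ℝ (⊤ : ℕ∞) β) (κ s : ℝ) {x : EuclideanSpace ℝ (Fin N)} (hx : x ≠ 0)
    (i : Fin N) :
    fderiv ℝ (coneCutoff P α β κ s) x (EuclideanSpace.single i 1) =
      deriv α (κ * Real.log ‖x‖) * κ * (‖x‖ ^ 2)⁻¹ * β (s * radExt P x ^ 2) * x i +
      α (κ * Real.log ‖x‖) * deriv β (s * radExt P x ^ 2) * (2 * s * radExt P x) *
        fderiv ℝ (radExt P) x (EuclideanSpace.single i 1) := by
  have hp : HasFDerivAt (radExt P) _ x :=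
    (((hP.contDiffOn_radExt).contDiffAt (isOpen_compl_singleton.mem_nhds hx)).differentiableAt
      (by simp)).hasFDerivAt
  have h1 := ((hα.differentiable (by simp)) (κ * Real.log ‖x‖)).hasDerivAt.comp_hasFDerivAt x
    ((hasFDerivAt_log_norm hx).const_mul κ)
  have h2 := ((hβ.differentiable (by simp)) (s * radExt P x ^ 2)).hasDerivAt.comp_hasFDerivAt x
    ((hp.pow 2).const_mul s)
  have h3 : HasFDerivAt (coneCutoff P α β κ s) _ x := h1.fun_mul h2
  rw [h3.fderiv]
  simp [EuclideanSpace.inner_single_right]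
  ring

theorem IsSphEigen.sum_groundState_mul_fderiv_coneCutoff_sq_le {N ℓ : ℕ}
    {P : EuclideanSpace ℝ (Fin N) → ℝ}
    (hP : IsSphEigen N ℓ P) {α β : ℝ → ℝ} (hα : ContDiff ℝ (⊤ : ℕ∞) α)
    (hβ : ContDiff ℝ (⊤ : ℕ∞) β) (κ s : ℝ) {x : EuclideanSpace ℝ (Fin N)} (hx : x ≠ 0) :
    ∑ i, (groundState N ℓ P x *
        fderiv ℝ (coneCutoff P α β κ s) x (EuclideanSpace.single i 1)) ^ 2 ≤
      2 * ((radExt P x * β (s * radExt P x ^ 2)) ^ 2 *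
        ((κ * deriv α (κ * Real.log ‖x‖)) ^ 2 * (‖x‖ ^ N)⁻¹)) +
      2 * (angularDensity P α κ x *
        (s * radExt P x ^ 2 * deriv β (s * radExt P x ^ 2)) ^ 2) := by
  have hne : ‖x‖ ≠ 0 := norm_ne_zero_iff.2 hx
  set A := deriv α (κ * Real.log ‖x‖) * κ * (‖x‖ ^ 2)⁻¹ * β (s * radExt P x ^ 2) with hA
  set B := α (κ * Real.log ‖x‖) * deriv β (s * radExt P x ^ 2) * (2 * s * radExt P x) with hB
  calc
    _ ≤ ∑ i, groundState N ℓ P x ^ 2 * (2 * A ^ 2 * x i ^ 2 +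
        2 * B ^ 2 * fderiv ℝ (radExt P) x (EuclideanSpace.single i 1) ^ 2) := by
      refine Finset.sum_le_sum fun i _ => ?_
      rw [hP.fderiv_coneCutoff hα hβ κ s hx i, mul_pow]
      refine mul_le_mul_of_nonneg_left ?_ (sq_nonneg _)
      nlinarith [sq_nonneg (A * x i - B * fderiv ℝ (radExt P) x (EuclideanSpace.single i 1))]
    _ = _ := by
      rw [← Finset.mul_sum, Finset.sum_add_distrib, ← Finset.mul_sum, ← Finset.mul_sum,
        ← EuclideanSpace.real_norm_sq_eq, groundState_sq hx, hA, hB, angularDensity]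
      field_simp
      ring

theorem IsSphEigen.continuousOn_angularDensity {N ℓ : ℕ} {P : EuclideanSpace ℝ (Fin N) → ℝ}
    (hP : IsSphEigen N ℓ P) {α : ℝ → ℝ} (hα : Continuous α) (κ : ℝ) :
    ContinuousOn (angularDensity P α κ) {0}ᶜ := by
  have h1 : ContinuousOn (fderiv ℝ (radExt P)) {0}ᶜ :=
    hP.contDiffOn_radExt.continuousOn_fderiv_of_isOpen isOpen_compl_singleton (by simp)
  have h2 : ContinuousOn (fun x : EuclideanSpace ℝ (Fin N) => (‖x‖ ^ N)⁻¹) {0}ᶜ :=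
    (continuous_norm.pow N).continuousOn.inv₀ fun x hx => pow_ne_zero N (norm_ne_zero_iff.2 hx)
  exact ((continuousOn_const.mul ((continuous_norm.pow 2).continuousOn.mul h2)).mul
    ((hα.comp_continuousOn (continuousOn_mul_log_norm κ)).pow 2)).mul
    (continuousOn_finsetSum _ fun i _ => (h1.clm_apply continuousOn_const).pow 2)

/-- The angular part of the energy of the test functions tends to zero. -/
theorem IsSphEigen.tendsto_integral_angularDensity {N ℓ : ℕ} {P : EuclideanSpace ℝ (Fin N) → ℝ}
    (hP : IsSphEigen N ℓ P) {α : ℝ → ℝ} (hα : Continuous α)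
    (hα0 : ∀ t ∉ Set.Icc (1 : ℝ) 3, α t = 0) {τ : ℝ → ℝ} (hτ : Continuous τ)
    (hτ0 : ∀ t ∉ Set.Icc (1 : ℝ) 2, τ t = 0) {κ : ℝ} (hκ : 0 < κ) :
    Filter.Tendsto (fun s : ℝ => ∫ x, angularDensity P α κ x * τ (s * radExt P x ^ 2) ^ 2)
      Filter.atTop (nhds 0) := by
  have hp := hP.contDiffOn_radExt.continuousOn
  have hG0 : ∀ x : EuclideanSpace ℝ (Fin N), κ * Real.log ‖x‖ ∉ Set.Icc (1 : ℝ) 3 →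
      angularDensity P α κ x = 0 := fun x hx => by simp [angularDensity, hα0 _ hx]
  have hGn : ∀ x, 0 ≤ angularDensity P α κ x := fun x => by
    rw [angularDensity]
    positivity
  obtain ⟨M, hM⟩ := hτ.bounded_above_of_compact_support
    (HasCompactSupport.intro isCompact_Icc hτ0)
  have h := tendsto_integral_filter_of_dominated_convergence (μ := volume) (l := Filter.atTop)
    (F := fun s x => angularDensity P α κ x * τ (s * radExt P x ^ 2) ^ 2) (f := fun _ => 0)
    (fun x => angularDensity P α κ x * M ^ 2)
    (Filter.Eventually.of_forall fun s =>
      (integrable_of_eq_zero_off_log_annulus (b := 3) hκ one_pos ((hP.continuousOn_angularDensity hα κ).mul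
        ((hτ.comp_continuousOn (continuousOn_const.mul (hp.pow 2))).pow 2))
        fun x hx => by simp [hG0 x hx]).aestronglyMeasurable)
    (Filter.Eventually.of_forall fun s => Filter.Eventually.of_forall fun x => by
      rw [Real.norm_of_nonneg (mul_nonneg (hGn x) (sq_nonneg _))]
      exact mul_le_mul_of_nonneg_left (sq_le_sq' (neg_le_of_abs_le (hM _))
        (le_of_abs_le (hM _))) (hGn x))
    (integrable_of_eq_zero_off_log_annulus (b := 3) hκ one_pos
      ((hP.continuousOn_angularDensity hα κ).mul continuousOn_const)
      fun x hx => by simp [hG0 x hx])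
    (Filter.Eventually.of_forall fun x => by
      refine tendsto_const_nhds.congr' ?_
      by_cases hx : radExt P x = 0
      · have : τ 0 = 0 := hτ0 0 (by simp)
        simp [hx, this]
      · have hpos : 0 < radExt P x ^ 2 := by positivity
        filter_upwards [Filter.eventually_gt_atTop (2 / radExt P x ^ 2)] with s hs
        rw [div_lt_iff₀ hpos] at hs
        simp [hτ0 (s * radExt P x ^ 2) fun h => hs.not_ge h.2])
  simpa using h

/-- The test functions for the optimality of the constant. -/
theorem IsSphEigen.exists_test_function {N ℓ : ℕ}
    [Nontrivial (EuclideanSpace ℝ (Fin N))] {P : EuclideanSpace ℝ (Fin N) → ℝ}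
    (hP : IsSphEigen N ℓ P) {α β : ℝ → ℝ} (hα : ContDiff ℝ (⊤ : ℕ∞) α)
    (hα0 : ∀ t ∉ Set.Icc (1 : ℝ) 3, α t = 0) (hβ : ContDiff ℝ (⊤ : ℕ∞) β)
    (hβ0 : ∀ t < 1, β t = 0) {κ : ℝ} (hκ : 0 < κ) (s : ℝ) :
    ∃ u : EuclideanSpace ℝ (Fin N) → ℂ,
      ContDiff ℝ (⊤ : ℕ∞) u ∧ HasCompactSupport u ∧ tsupport u ⊆ (conicZeroSet N P)ᶜ ∧
      (∀ x ≠ 0, ‖u x‖ ^ 2 / ‖x‖ ^ 2 = (radExt P x * β (s * radExt P x ^ 2)) ^ 2 *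
        (α (κ * Real.log ‖x‖) ^ 2 * (‖x‖ ^ N)⁻¹)) ∧
      ∫ x, gradSq u x ≤
        ((((N : ℝ) - 2) / 2) ^ 2 + (ℓ : ℝ) * ((N : ℝ) - 2 + ℓ)) *
          (∫ x, ‖u x‖ ^ 2 / ‖x‖ ^ 2) +
        (2 * (∫ x, (radExt P x * β (s * radExt P x ^ 2)) ^ 2 *
          ((κ * deriv α (κ * Real.log ‖x‖)) ^ 2 * (‖x‖ ^ N)⁻¹)) +
        2 * ∫ x, angularDensity P α κ x *
          (s * radExt P x ^ 2 * deriv β (s * radExt P x ^ 2)) ^ 2) := by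
  have hp := hP.contDiffOn_radExt.continuousOn
  have hv := hP.contDiffOn_coneCutoff hα hβ κ s
  let A : Set (EuclideanSpace ℝ (Fin N)) := {x | κ * Real.log ‖x‖ ∈ Set.Icc (1 : ℝ) 3}
  have hAc : IsCompact A := isCompact_setOf_log_norm_mem_Icc hκ one_pos
  have hA0 : A ⊆ {0}ᶜ := fun x hx h => by
    simp only [Set.mem_singleton_iff] at h
    simp [A, h] at hx
    linarith
  let K := A ∩ (fun x => s * radExt P x ^ 2) ⁻¹' Set.Ici 1
  have hKcl : IsClosed K :=
    (continuousOn_const.mul ((hp.mono hA0).pow 2)).preimage_isClosed_of_isClosed hAc.isClosed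
      isClosed_Ici
  have hKc : IsCompact K := hAc.of_isClosed_subset hKcl Set.inter_subset_left
  have hKU : K ⊆ (conicZeroSet N P)ᶜ := fun x hx => by
    have hx0 : x ≠ 0 := hA0 hx.1
    refine (mem_compl_conicZeroSet (ℓ := ℓ)).2 ⟨hx0, fun h => ?_⟩
    rw [homExt_eq] at h
    have h1 : radExt P x = 0 :=
      (mul_eq_zero.1 h).resolve_left (pow_ne_zero ℓ (norm_ne_zero_iff.2 hx0))
    have h2 : (1 : ℝ) ≤ s * radExt P x ^ 2 := hx.2
    norm_num [h1] at h2
  have hv0 : ∀ x ∉ K, coneCutoff P α β κ s x = 0 := fun x hx => by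
    by_cases h : x ∈ A
    · have : s * radExt P x ^ 2 < 1 := not_le.1 fun h' => hx ⟨h, h'⟩
      simp [coneCutoff, hβ0 _ this]
    · simp [coneCutoff, hα0 _ h]
  let u : EuclideanSpace ℝ (Fin N) → ℂ := fun x =>
    ((groundState N ℓ P x * coneCutoff P α β κ s x : ℝ) : ℂ)
  have hu0 : ∀ x ∉ K, u x = 0 := fun x hx => by simp [u, hv0 x hx]
  have hu : ContDiff ℝ (⊤ : ℕ∞) u := by
    refine contDiff_of_eq_zero_off isOpen_compl_singleton (fun x hx => ?_) hKcl
      (Set.inter_subset_left.trans hA0) hu0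
    exact Complex.ofRealCLM.contDiff.contDiffAt.comp_contDiffWithinAt x
      ((hP.contDiffAt_groundState hx).contDiffWithinAt.mul (hv x hx))
  have huc : HasCompactSupport u := HasCompactSupport.intro hKc hu0
  have hus : tsupport u ⊆ (conicZeroSet N P)ᶜ :=
    (closure_minimal (Function.support_subset_iff'.2 hu0) hKcl).trans hKU
  have hgrad : ∀ x i, ‖fderiv ℝ u x (EuclideanSpace.single i 1)
      - logGrad (-((N : ℝ) - 2) / 2 - ℓ) (homExt N ℓ P) i x • u x‖ ^ 2 =
      (groundState N ℓ P x *
        fderiv ℝ (coneCutoff P α β κ s) x (EuclideanSpace.single i 1)) ^ 2 := fun x i => by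
    by_cases hx : x ∈ K
    · rw [hP.fderiv_groundState_mul_sub (hKU hx) ((hv.contDiffAt
        (isOpen_compl_singleton.mem_nhds (hA0 hx.1))).differentiableAt (by simp)) i,
        Complex.norm_real, Real.norm_eq_abs, sq_abs]
    · have hnhds := hKcl.isOpen_compl.mem_nhds hx
      have h1 : u =ᶠ[nhds x] fun _ => 0 := by filter_upwards [hnhds] with y hy using hu0 y hy
      have h2 : coneCutoff P α β κ s =ᶠ[nhds x] fun _ => 0 := by
        filter_upwards [hnhds] with y hy using hv0 y hy
      simp [h1.fderiv_eq, h2.fderiv_eq, hu0 x hx]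
  have hα'0 := deriv_eq_zero_off isClosed_Icc hα0
  have hNinv : ContinuousOn (fun x : EuclideanSpace ℝ (Fin N) => (‖x‖ ^ N)⁻¹) {0}ᶜ :=
    (continuous_norm.pow N).continuousOn.inv₀ fun x hx => pow_ne_zero N (norm_ne_zero_iff.2 hx)
  have hsp : ContinuousOn (fun x => s * radExt P x ^ 2) {0}ᶜ := continuousOn_const.mul (hp.pow 2)
  have hi1 : Integrable fun x => (radExt P x * β (s * radExt P x ^ 2)) ^ 2 *
      ((κ * deriv α (κ * Real.log ‖x‖)) ^ 2 * (‖x‖ ^ N)⁻¹) :=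
    integrable_of_eq_zero_off_log_annulus (b := 3) hκ one_pos
      (((hp.mul (hβ.continuous.comp_continuousOn hsp)).pow 2).mul
        (((continuousOn_const.mul ((hα.continuous_deriv (by simp)).comp_continuousOn
          (continuousOn_mul_log_norm κ))).pow 2).mul hNinv))
      fun x hx => by simp [hα'0 _ hx]
  have hi2 : Integrable fun x => angularDensity P α κ x *
      (s * radExt P x ^ 2 * deriv β (s * radExt P x ^ 2)) ^ 2 :=
    integrable_of_eq_zero_off_log_annulus (b := 3) hκ one_pos
      ((hP.continuousOn_angularDensity hα.continuous κ).mul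
        ((hsp.mul ((hβ.continuous_deriv (by simp)).comp_continuousOn hsp)).pow 2))
      fun x hx => by simp [angularDensity, hα0 _ hx]
  refine ⟨u, hu, huc, hus, fun x hx => ?_, ?_⟩
  · have : ‖x‖ ≠ 0 := norm_ne_zero_iff.2 hx
    simp only [u, Complex.norm_real, Real.norm_eq_abs, sq_abs]
    rw [mul_pow, groundState_sq hx, coneCutoff]
    field_simp
  · rw [hP.integral_gradSq_eq (hu.of_le (by simp)) huc hus, ← integral_const_mul 2,
      ← integral_const_mul 2, ← integral_add (hi1.const_mul 2) (hi2.const_mul 2)]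
    simp_rw [hgrad]
    refine add_le_add le_rfl ?_
    refine integral_mono_of_nonneg (Filter.Eventually.of_forall fun x =>
      Finset.sum_nonneg fun i _ => sq_nonneg _) ((hi1.const_mul 2).add (hi2.const_mul 2)) ?_
    filter_upwards [compl_mem_ae_iff.2 (measure_singleton (μ := volume) 0)] with x hx
    exact hP.sum_groundState_mul_fderiv_coneCutoff_sq_le hα hβ κ s hx

/-- A smooth step function. -/
theorem exists_smooth_monotone_step : ∃ β : ℝ → ℝ, ContDiff ℝ (⊤ : ℕ∞) β ∧ (∀ t < 1, β t = 0) ∧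
    (∀ t, 0 ≤ β t) ∧ Monotone β ∧ (∀ t ∉ Set.Icc (1 : ℝ) 2, t * deriv β t = 0) ∧ β 2 = 1 := by
  let β : ℝ → ℝ := fun t => Real.smoothTransition (t - 1)
  have hβ : ContDiff ℝ (⊤ : ℕ∞) β :=
    Real.smoothTransition.contDiff.comp (contDiff_id.sub contDiff_const)
  have hβ0 : ∀ t < 1, β t = 0 := fun t ht =>
    Real.smoothTransition.zero_of_nonpos (by linarith)
  have hβn : ∀ t, 0 ≤ β t := fun t => Real.smoothTransition.nonneg _
  have hβm : Monotone β := fun a b h => Real.smoothTransition.monotone (by linarith)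
  have hτ0 : ∀ t ∉ Set.Icc (1 : ℝ) 2, t * deriv β t = 0 := fun t ht => by
    rw [Set.mem_Icc, not_and_or, not_le, not_le] at ht
    have h : ∃ c, β =ᶠ[nhds t] fun _ => c := by
      rcases ht with h | h
      · exact ⟨0, by filter_upwards [Iio_mem_nhds h] with y hy using hβ0 y hy⟩
      · exact ⟨1, by
          filter_upwards [Ioi_mem_nhds h] with y hy
          exact Real.smoothTransition.one_of_one_le (by linarith [Set.mem_Ioi.1 hy])⟩
    obtain ⟨c, hc⟩ := h
    rw [hc.deriv_eq, deriv_const, mul_zero]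
  exact ⟨β, hβ, hβ0, hβn, hβm, hτ0, Real.smoothTransition.one_of_one_le (by norm_num)⟩

/-- Some admissible function has Rayleigh quotient at most `c + 2 κ² (∫ |α′|² / ∫ α²) + δ`, where
`c` is the Hardy constant. -/
theorem IsSphEigen.exists_integral_gradSq_le {N ℓ : ℕ} [Nontrivial (EuclideanSpace ℝ (Fin N))]
    {P : EuclideanSpace ℝ (Fin N) → ℝ}
    (hP : IsSphEigen N ℓ P) (hP0 : SphNonzero N P) {α : ℝ → ℝ} (hα : ContDiff ℝ (⊤ : ℕ∞) α)
    (hα0 : ∀ t ∉ Set.Icc (1 : ℝ) 3, α t = 0) (hα2 : α 2 ≠ 0) {κ δ : ℝ} (hκ : 0 < κ)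
    (hδ : 0 < δ) :
    ∃ u : EuclideanSpace ℝ (Fin N) → ℂ,
      ContDiff ℝ (⊤ : ℕ∞) u ∧ HasCompactSupport u ∧ tsupport u ⊆ (conicZeroSet N P)ᶜ ∧
      0 < (∫ x, ‖u x‖ ^ 2 / ‖x‖ ^ 2) ∧
      ∫ x, gradSq u x ≤
        ((((N : ℝ) - 2) / 2) ^ 2 + (ℓ : ℝ) * ((N : ℝ) - 2 + ℓ) +
          2 * κ ^ 2 * ((∫ t, deriv α t ^ 2) / ∫ t, α t ^ 2) + δ) *
          (∫ x, ‖u x‖ ^ 2 / ‖x‖ ^ 2) := by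
  obtain ⟨β, hβ, hβ0, hβn, hβm, hτ0, hβ2⟩ := exists_smooth_monotone_step
  have hp := hP.contDiffOn_radExt.continuousOn
  have hNinv : ContinuousOn (fun x : EuclideanSpace ℝ (Fin N) => (‖x‖ ^ N)⁻¹) {0}ᶜ :=
    (continuous_norm.pow N).continuousOn.inv₀ fun x hx => pow_ne_zero N (norm_ne_zero_iff.2 hx)
  let G : ℝ → EuclideanSpace ℝ (Fin N) → ℝ := fun s x =>
    (radExt P x * β (s * radExt P x ^ 2)) ^ 2 * (α (κ * Real.log ‖x‖) ^ 2 * (‖x‖ ^ N)⁻¹)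
  have hGc : ∀ s, ContinuousOn (G s) {0}ᶜ := fun s =>
    ((hp.mul (hβ.continuous.comp_continuousOn (continuousOn_const.mul (hp.pow 2)))).pow 2).mul
      (((hα.continuous.comp_continuousOn (continuousOn_mul_log_norm κ)).pow 2).mul hNinv)
  have hGi : ∀ s, Integrable (G s) := fun s =>
    integrable_of_eq_zero_off_log_annulus (b := 3) hκ one_pos (hGc s)
      fun x hx => by simp [G, hα0 _ hx]
  have hGn : ∀ s x, 0 ≤ G s x := fun s x => by simp only [G]; positivity
  have hGm : ∀ x, Monotone fun s => G s x := fun x s s' h => by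
    have h1 := hβm (mul_le_mul_of_nonneg_right h (sq_nonneg (radExt P x)))
    have h2 := hβn (s * radExt P x ^ 2)
    simp only [G, mul_pow]
    gcongr
  obtain ⟨ω, hω, hPω⟩ := hP0
  let s₀ : ℝ := 2 / P ω ^ 2
  have hD₀ : 0 < ∫ x, G s₀ x := by
    let x₀ : EuclideanSpace ℝ (Fin N) := Real.exp (2 / κ) • ω
    have hn : ‖x₀‖ = Real.exp (2 / κ) := by
      rw [norm_smul, hω, mul_one, Real.norm_of_nonneg (Real.exp_nonneg _)]
    have hx₀ : x₀ ≠ 0 := norm_ne_zero_iff.1 (hn ▸ (Real.exp_pos _).ne')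
    have hr : radExt P x₀ = P ω := by
      rw [radExt_smul P (Real.exp_pos _), radExt, hω, inv_one, one_smul]
    have hG : G s₀ x₀ ≠ 0 := by
      have h1 : s₀ * P ω ^ 2 = 2 := div_mul_cancel₀ _ (pow_ne_zero 2 hPω)
      have h2 : κ * Real.log ‖x₀‖ = 2 := by
        rw [hn, Real.log_exp]
        field_simp
      simp only [G, hr, h1, h2, hβ2]
      have := norm_ne_zero_iff.2 hx₀
      positivity
    refine (integral_pos_iff_support_of_nonneg (hGn s₀) (hGi s₀)).2 ?_
    have hnhds : Function.support (G s₀) ∈ nhds x₀ :=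
      ((hGc s₀).continuousAt (isOpen_compl_singleton.mem_nhds hx₀)).eventually_ne hG
    exact Measure.measure_pos_of_mem_nhds volume hnhds
  have hB : 0 < ∫ t, α t ^ 2 :=
    (hα.continuous.pow 2).integral_pos_of_hasCompactSupport_nonneg_nonzero
      (HasCompactSupport.intro (isCompact_Icc (a := (1 : ℝ)) (b := 3))
        fun t ht => by simp [hα0 t ht])
      (fun t => sq_nonneg _) (pow_ne_zero 2 hα2)
  have hlim := hP.tendsto_integral_angularDensity hα.continuous hα0
    (τ := fun t => t * deriv β t) (continuous_id.mul (hβ.continuous_deriv (by simp))) hτ0 hκ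
  have hev := (hlim.eventually (gt_mem_nhds (mul_pos (half_pos hδ) hD₀))).and
    (Filter.eventually_ge_atTop s₀)
  obtain ⟨s, hs, hs₀⟩ := hev.exists
  obtain ⟨u, hu, huc, hus, hu2, hle⟩ := hP.exists_test_function hα hα0 hβ hβ0 hκ s
  have hD : ∫ x, ‖u x‖ ^ 2 / ‖x‖ ^ 2 = ∫ x, G s x := by
    refine integral_congr_ae ?_
    filter_upwards [compl_mem_ae_iff.2 (measure_singleton (μ := volume) 0)] with x hx
    exact hu2 x hx
  have hmono : ∫ x, G s₀ x ≤ ∫ x, G s x := integral_mono (hGi s₀) (hGi s) fun x => hGm x hs₀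
  let g : EuclideanSpace ℝ (Fin N) → ℝ := fun x => (radExt P x * β (s * radExt P x ^ 2)) ^ 2
  have hg : ∀ t : ℝ, 0 < t → ∀ x, g (t • x) = g x := fun t ht x => by
    simp only [g, radExt_smul P ht]
  have h1 := integral_log_norm_mul_homogeneous volume hg fun t => α (κ * t) ^ 2
  have h2 := integral_log_norm_mul_homogeneous volume hg fun t => (κ * deriv α (κ * t)) ^ 2
  rw [finrank_euclideanSpace_fin, Measure.integral_comp_mul_left (fun t => α t ^ 2)] at h1
  rw [finrank_euclideanSpace_fin,
    Measure.integral_comp_mul_left (fun t => (κ * deriv α t) ^ 2)] at h2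
  simp only [mul_pow κ, integral_const_mul, smul_eq_mul] at h2
  have hI : ∫ x, (radExt P x * β (s * radExt P x ^ 2)) ^ 2 *
      ((κ * deriv α (κ * Real.log ‖x‖)) ^ 2 * (‖x‖ ^ N)⁻¹) =
      κ ^ 2 * ((∫ t, deriv α t ^ 2) / ∫ t, α t ^ 2) * ∫ x, G s x := by
    change ∫ x, g x * _ = _ * ∫ x, g x * _
    simp only [mul_pow κ]
    rw [h1, h2, smul_eq_mul]
    field_simp
  refine ⟨u, hu, huc, hus, hD ▸ hD₀.trans_le hmono, hle.trans ?_⟩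
  rw [hI, hD]
  have h3 := mul_le_mul_of_nonneg_left hmono (half_pos hδ).le
  linarith

theorem integral_norm_const_smul_sq_div {N : ℕ} (c : ℝ) (u : EuclideanSpace ℝ (Fin N) → ℂ) :
    ∫ x, ‖(c • u) x‖ ^ 2 / ‖x‖ ^ 2 = c ^ 2 * ∫ x, ‖u x‖ ^ 2 / ‖x‖ ^ 2 := by
  simp only [Pi.smul_apply, norm_smul, mul_pow, Real.norm_eq_abs, sq_abs, mul_div_assoc,
    integral_const_mul]

theorem integral_gradSq_const_smul {N : ℕ} (c : ℝ) {u : EuclideanSpace ℝ (Fin N) → ℂ}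
    (hu : Differentiable ℝ u) :
    ∫ x, gradSq (c • u) x = c ^ 2 * ∫ x, gradSq u x := by
  rw [← integral_const_mul]
  congr 1 with x
  simp only [gradSq, fderiv_const_smul (hu x), smul_apply, norm_smul, mul_pow,
    Real.norm_eq_abs, sq_abs, Finset.mul_sum]

theorem stmt8 (N ℓ : ℕ) (hN : 2 ≤ N) (P : EuclideanSpace ℝ (Fin N) → ℝ)
    (hP : IsSphEigen N ℓ P) (hP0 : SphNonzero N P) :
    sInf {r : ℝ | ∃ u : EuclideanSpace ℝ (Fin N) → ℂ,
        ContDiff ℝ (⊤ : ℕ∞) u ∧ HasCompactSupport u ∧ tsupport u ⊆ (conicZeroSet N P)ᶜ ∧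
        (∫ x, ‖u x‖ ^ 2 / ‖x‖ ^ 2) = 1 ∧ r = ∫ x, gradSq u x}
      = (((N : ℝ) - 2)/2) ^ 2 + (ℓ : ℝ) * ((N : ℝ) - 2 + ℓ) := by
  have : Nontrivial (EuclideanSpace ℝ (Fin N)) :=
    Module.nontrivial_of_finrank_pos (R := ℝ) (by rw [finrank_euclideanSpace_fin]; omega)
  let b : ContDiffBump (2 : ℝ) := ⟨1 / 2, 1, by norm_num, by norm_num⟩
  have hb0 : ∀ t ∉ Set.Icc (1 : ℝ) 3, b t = 0 := fun t ht =>
    b.zero_of_le_dist (not_lt.1 fun h => ht (by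
      rw [Real.dist_eq, abs_lt] at h
      exact ⟨by linarith [h.1], by linarith [h.2]⟩))
  have hb2 : b 2 ≠ 0 := by
    rw [b.one_of_mem_closedBall (mem_closedBall_self b.rIn_pos.le)]
    exact one_ne_zero
  set Q := (∫ t, deriv b t ^ 2) / ∫ t, b t ^ 2 with hQ
  have hQ0 : 0 ≤ Q := div_nonneg (integral_nonneg fun t => sq_nonneg _)
    (integral_nonneg fun t => sq_nonneg _)
  have key : ∀ w : ℝ, (((N : ℝ) - 2) / 2) ^ 2 + (ℓ : ℝ) * ((N : ℝ) - 2 + ℓ) < w →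
      ∃ r ∈ {r : ℝ | ∃ u : EuclideanSpace ℝ (Fin N) → ℂ,
        ContDiff ℝ (⊤ : ℕ∞) u ∧ HasCompactSupport u ∧ tsupport u ⊆ (conicZeroSet N P)ᶜ ∧
        (∫ x, ‖u x‖ ^ 2 / ‖x‖ ^ 2) = 1 ∧ r = ∫ x, gradSq u x}, r < w := fun w hw => by
    set c := (((N : ℝ) - 2) / 2) ^ 2 + (ℓ : ℝ) * ((N : ℝ) - 2 + ℓ) with hc
    obtain ⟨u, hu, huc, hus, hD, hle⟩ := hP.exists_integral_gradSq_le hP0 b.contDiff hb0 hb2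
      (κ := √((w - c) / (8 * (Q + 1)))) (δ := (w - c) / 2)
      (Real.sqrt_pos.2 (div_pos (by linarith) (by linarith))) (by linarith)
    rw [← hc, ← hQ, Real.sq_sqrt (div_nonneg (by linarith) (by linarith))] at hle
    set D := ∫ x, ‖u x‖ ^ 2 / ‖x‖ ^ 2 with hDdef
    have hsq : (√D)⁻¹ ^ 2 = D⁻¹ := by rw [inv_pow, Real.sq_sqrt hD.le]
    refine ⟨_, ⟨(√D)⁻¹ • u, contDiff_const.smul hu,
      huc.mono (Function.support_const_smul_subset _ _),
      (closure_mono (Function.support_const_smul_subset _ _)).trans hus, ?_, rfl⟩, ?_⟩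
    · rw [integral_norm_const_smul_sq_div, hsq, ← hDdef, inv_mul_cancel₀ hD.ne']
    · rw [integral_gradSq_const_smul _ (hu.differentiable (by simp)), hsq, inv_mul_lt_iff₀ hD,
        mul_comm D]
      refine hle.trans_lt (mul_lt_mul_of_pos_right ?_ hD)
      have h : (w - c) / (8 * (Q + 1)) * Q ≤ (w - c) / 8 := by
        rw [div_mul_eq_mul_div, div_le_div_iff₀ (by linarith) (by norm_num)]
        nlinarith
      linarith
  refine csInf_eq_of_forall_ge_of_forall_gt_exists_lt ?_ ?_ key
  · obtain ⟨r, hr, -⟩ := key _ (lt_add_one _)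
    exact ⟨r, hr⟩
  · rintro r ⟨u, hu, huc, hus, h1, rfl⟩
    rw [hP.integral_gradSq_eq (hu.of_le (by simp)) huc hus, h1, mul_one]
    exact le_add_of_nonneg_right (integral_nonneg fun x => Finset.sum_nonneg fun i _ => sq_nonneg _)
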